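/- Let α, β ∈ ℂ with |α| = |β| = 1, and suppose βⁿ ≠ 1 for every nonzero integer n. Let T be the operator on holomorphic functions on 𝔸 defined by (Tf)(z) = α·f(β·z). Then a complex number λ is an eigenvalue of T (i.e. there exists a holomorphic f on 𝔸, not identically zero, with α·f(β·z) = λ·f(z) for all z ∈ 𝔸) if and only if λ = α·βᵏ for some k ∈ ℤ; moreover, for each k ∈ ℤ the eigenspace of α·βᵏ is one-dimensional, consisting exactly of the scalar multiples of the function z ↦ zᵏ. -/

import Mathlib

open Complex Set

/-- The open annulus `{z : 1/R < |z| < R}`, symmetric with respect to the unit circle. -/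
def ann (R : ℝ) : Set ℂ := {z : ℂ | 1 / R < ‖z‖ ∧ ‖z‖ < R}

/-- If a continuous function on the circle is multiplied by `μ` under translation by `b`, then only
those Fourier coefficients can be nonzero whose character takes the value `μ` at `b`. -/
theorem eq_fourier_of_translate_eq_mul {T : ℝ} [Fact (0 < T)] {h : AddCircle T → ℂ}
    {b : AddCircle T} {μ : ℂ} (hb : ∀ t, h (t + b) = μ * h t) {n : ℤ}
    (hn : fourierCoeff h n ≠ 0) : μ = fourier n b := by
  have key : fourierCoeff h n = fourier (-n) b * μ * fourierCoeff h n := by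
    conv_lhs => rw [fourierCoeff,
      ← MeasureTheory.integral_add_right_eq_self (μ := AddCircle.haarAddCircle) _ b]
    rw [fourierCoeff, ← MeasureTheory.integral_const_mul]
    congr 1
    ext t
    have : fourier (-n) (t + b) = fourier (-n) t * fourier (-n) b := by
      simp [fourier_apply, smul_add, AddCircle.toCircle_add]
    rw [hb, this, smul_eq_mul, smul_eq_mul]
    ring
  have h1 : fourier (-n) b * μ = 1 :=
    mul_right_cancel₀ hn (by rw [one_mul]; exact key.symm)
  have h2 : fourier n b * fourier (-n) b = 1 := by
    rw [← fourier_add, add_neg_cancel, fourier_zero]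
  calc μ = fourier n b * fourier (-n) b * μ := by rw [h2, one_mul]
    _ = fourier n b := by rw [mul_assoc, h1, mul_one]

/-- A continuous function on the circle with at most one nonzero Fourier coefficient is a multiple
of the corresponding character. -/
theorem eq_mul_fourier_of_fourierCoeff_eq_zero {T : ℝ} [Fact (0 < T)] (h : C(AddCircle T, ℂ))
    (k : ℤ) (hk : ∀ n, n ≠ k → fourierCoeff h n = 0) (t : AddCircle T) :
    h t = fourierCoeff h k * fourier k t := by
  have hs : Summable (fourierCoeff h) :=
    summable_of_ne_finset_zero (s := {k}) fun n hn => hk n (by simpa using hn)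
  refine (has_pointwise_sum_fourier_series_of_summable hs t).unique ?_
  exact hasSum_single k fun n hn => by simp [hk n hn]

theorem fourier_eq_toCircle_zpow {T : ℝ} (n : ℤ) (t : AddCircle T) :
    fourier n t = (AddCircle.toCircle t : ℂ) ^ n := by
  rw [fourier_apply, AddCircle.toCircle_zsmul, Circle.coe_zpow]

theorem exists_toCircle_eq {w : ℂ} (hw : ‖w‖ = 1) :
    ∃ t : UnitAddCircle, (AddCircle.toCircle t : ℂ) = w := by
  obtain ⟨t, ht⟩ := (AddCircle.homeomorphCircle (T := 1) one_ne_zero).surjective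
    ⟨w, mem_sphere_zero_iff_norm.2 hw⟩
  rw [AddCircle.homeomorphCircle_apply] at ht
  exact ⟨t, by rw [ht]⟩

theorem ne_zero_of_mem_ann {R : ℝ} (hR : 1 < R) {z : ℂ} (hz : z ∈ ann R) : z ≠ 0 :=
  norm_pos_iff.1 (lt_trans (by positivity) hz.1)

theorem circle_mul_mem_ann {R : ℝ} {z : ℂ} (hz : z ∈ ann R) (u : Circle) :
    (u : ℂ) * z ∈ ann R := by
  rwa [ann, mem_ofPred_eq, norm_mul, Circle.norm_coe, one_mul]

theorem isOpen_ann (R : ℝ) : IsOpen (ann R) :=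
  (isOpen_lt continuous_const continuous_norm).inter (isOpen_lt continuous_norm continuous_const)

theorem mem_ann_of_norm_eq_one {R : ℝ} (hR : 1 < R) {z : ℂ} (hz : ‖z‖ = 1) : z ∈ ann R :=
  ⟨by rw [hz, div_lt_one (by linarith)]; exact hR, by rwa [hz]⟩

theorem isPreconnected_ann {R : ℝ} (hR : 1 < R) : IsPreconnected (ann R) := by
  have hR0 : 0 < R := by linarith
  have himage : ann R = Complex.exp '' (Complex.re ⁻¹' Ioo (-Real.log R) (Real.log R)) := by
    ext z
    constructor
    · intro hz
      have hz0 := ne_zero_of_mem_ann hR hz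
      refine ⟨Complex.log z, ⟨?_, ?_⟩, Complex.exp_log hz0⟩
      · rw [Complex.log_re, ← Real.log_inv, ← one_div]
        exact Real.log_lt_log (by positivity) hz.1
      · rw [Complex.log_re]
        exact Real.log_lt_log (norm_pos_iff.2 hz0) hz.2
    · rintro ⟨w, hw, rfl⟩
      constructor
      · rw [Complex.norm_exp, one_div, ← Real.exp_log (inv_pos.2 hR0), Real.log_inv]
        exact Real.exp_lt_exp.2 hw.1
      · rw [Complex.norm_exp, ← Real.exp_log hR0]
        exact (Real.exp_lt_exp.2 hw.2).trans_eq (by rw [Real.exp_log hR0])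
  rw [himage]
  exact ((convex_Ioo _ _).linear_preimage Complex.reLm).isPreconnected.image _
    Complex.continuous_exp.continuousOn

/-- The restriction of a continuous function on the annulus to the circle through one of its
points, as a function on the additive circle. -/
noncomputable def circleRestrict {R : ℝ} {f : ℂ → ℂ} (hf : ContinuousOn f (ann R)) {z : ℂ}
    (hz : z ∈ ann R) : C(UnitAddCircle, ℂ) where
  toFun t := f (AddCircle.toCircle t * z)
  continuous_toFun := hf.comp_continuous
    ((continuous_subtype_val.comp AddCircle.continuous_toCircle).mul continuous_const)
    fun _ => circle_mul_mem_ann hz _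

theorem circleRestrict_apply {R : ℝ} {f : ℂ → ℂ} (hf : ContinuousOn f (ann R)) {z : ℂ}
    (hz : z ∈ ann R) (t : UnitAddCircle) :
    circleRestrict hf hz t = f (AddCircle.toCircle t * z) := rfl

theorem eq_zpow_of_fourierCoeff_circleRestrict_ne_zero {R : ℝ} {f : ℂ → ℂ}
    (hf : ContinuousOn f (ann R)) {z : ℂ} (hz : z ∈ ann R) {β μ : ℂ} (hβ : ‖β‖ = 1)
    (hμ : ∀ w ∈ ann R, f (β * w) = μ * f w) {n : ℤ}
    (hn : fourierCoeff (circleRestrict hf hz) n ≠ 0) : μ = β ^ n := by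
  obtain ⟨b, rfl⟩ := exists_toCircle_eq hβ
  rw [← fourier_eq_toCircle_zpow]
  refine eq_fourier_of_translate_eq_mul (fun t => ?_) hn
  rw [circleRestrict_apply, circleRestrict_apply, ← hμ _ (circle_mul_mem_ann hz _),
    AddCircle.toCircle_add, Circle.coe_mul]
  congr 1
  ring

/-- A nonzero continuous function on the annulus that is multiplied by `μ` under rotation by `β`
forces `μ` to be an integer power of `β`. -/
theorem exists_eq_zpow_of_rotate_eq_mul {R : ℝ} {f : ℂ → ℂ} (hf : ContinuousOn f (ann R))
    {β μ : ℂ} (hβ : ‖β‖ = 1) (hμ : ∀ w ∈ ann R, f (β * w) = μ * f w) {z : ℂ} (hz : z ∈ ann R)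
    (hfz : f z ≠ 0) : ∃ k : ℤ, μ = β ^ k := by
  by_contra! hne
  have h0 : ∀ n, fourierCoeff (circleRestrict hf hz) n = 0 := fun n => by
    by_contra hn
    exact hne n (eq_zpow_of_fourierCoeff_circleRestrict_ne_zero hf hz hβ hμ hn)
  have h1 := eq_mul_fourier_of_fourierCoeff_eq_zero _ 0 (fun n _ => h0 n) (0 : UnitAddCircle)
  rw [circleRestrict_apply, h0, zero_mul] at h1
  simp at h1
  exact hfz h1

/-- A holomorphic function on the annulus that is multiplied by `β ^ k` under an aperiodic
rotation `β` is a multiple of `z ↦ z ^ k`. -/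
theorem eq_mul_zpow_of_rotate_eq_mul {R : ℝ} (hR : 1 < R) {f : ℂ → ℂ}
    (hf : DifferentiableOn ℂ f (ann R)) {β : ℂ} (hβ : ‖β‖ = 1)
    (hap : ∀ m : ℤ, m ≠ 0 → β ^ m ≠ 1) {k : ℤ} (hk : ∀ w ∈ ann R, f (β * w) = β ^ k * f w) :
    ∃ c : ℂ, ∀ z ∈ ann R, f z = c * z ^ k := by
  have h1 : (1 : ℂ) ∈ ann R := mem_ann_of_norm_eq_one hR norm_one
  have hβ0 : β ≠ 0 := norm_pos_iff.1 (by rw [hβ]; exact one_pos)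
  have hcoeff : ∀ n, n ≠ k → fourierCoeff (circleRestrict hf.continuousOn h1) n = 0 := by
    intro n hnk
    by_contra hn
    refine hap (k - n) (sub_ne_zero.2 hnk.symm) ?_
    rw [zpow_sub₀ hβ0, eq_zpow_of_fourierCoeff_circleRestrict_ne_zero _ h1 hβ hk hn,
      div_self (zpow_ne_zero _ hβ0)]
  refine ⟨fourierCoeff (circleRestrict hf.continuousOn h1) k, ?_⟩
  set c := fourierCoeff (circleRestrict hf.continuousOn h1) k
  have hunit : ∀ w : ℂ, ‖w‖ = 1 → f w = c * w ^ k := by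
    intro w hw
    obtain ⟨t, rfl⟩ := exists_toCircle_eq hw
    have := eq_mul_fourier_of_fourierCoeff_eq_zero _ k hcoeff t
    rwa [circleRestrict_apply, mul_one, fourier_eq_toCircle_zpow] at this
  have hg : DifferentiableOn ℂ (fun z : ℂ => c * z ^ k) (ann R) := fun z hz =>
    ((differentiableAt_zpow.2 (Or.inl (ne_zero_of_mem_ann hR hz))).const_mul c)
      |>.differentiableWithinAt
  refine (hf.analyticOnNhd (isOpen_ann R)).eqOn_of_preconnected_of_frequently_eq
    (hg.analyticOnNhd (isOpen_ann R)) (isPreconnected_ann hR) h1 ?_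
  have htend : Filter.Tendsto (fun t : ℝ => Complex.exp (t * I)) (nhdsWithin 0 {0}ᶜ)
      (nhdsWithin 1 {1}ᶜ) := by
    refine tendsto_nhdsWithin_iff.2 ⟨?_, ?_⟩
    · have : Continuous fun t : ℝ => Complex.exp (t * I) := by fun_prop
      simpa using (this.tendsto 0).mono_left nhdsWithin_le_nhds
    · have hball : Ioo (-1 : ℝ) 1 ∈ nhds (0 : ℝ) := Ioo_mem_nhds (by norm_num) (by norm_num)
      filter_upwards [self_mem_nhdsWithin, mem_nhdsWithin_of_mem_nhds hball] with t ht0 ht hexp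
      have him : Real.sin t = 0 := by
        simpa [Complex.exp_ofReal_mul_I_im] using congrArg Complex.im hexp
      have hpi := Real.pi_gt_three
      exact ht0 ((Real.sin_eq_zero_iff_of_lt_of_lt (by linarith [ht.1]) (by linarith [ht.2])).1 him)
  exact htend.frequently (Filter.Frequently.of_forall fun t =>
    hunit _ (Complex.norm_exp_ofReal_mul_I t))

/-- Let `(Tf)(z) = α f(βz)` with `|α| = |β| = 1` and `β` aperiodic (`βᵐ ≠ 1` for all
`m ≠ 0`). Then the eigenvalues of `T` are exactly the numbers `α·βᵏ`, `k ∈ ℤ`, and each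
eigenspace is one-dimensional, spanned by `z ↦ zᵏ`. -/
theorem stmt15 (R : ℝ) (hR : 1 < R) (α β : ℂ)
    (hα : ‖α‖ = 1) (hβ : ‖β‖ = 1)
    (hap : ∀ m : ℤ, m ≠ 0 → β ^ m ≠ 1) :
    (∀ lam : ℂ,
      (∃ f : ℂ → ℂ, DifferentiableOn ℂ f (ann R) ∧ (∃ z ∈ ann R, f z ≠ 0) ∧
          ∀ z ∈ ann R, α * f (β * z) = lam * f z) ↔
        ∃ k : ℤ, lam = α * β ^ k) ∧
    (∀ k : ℤ,
      (∀ f : ℂ → ℂ, DifferentiableOn ℂ f (ann R) →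
        (∀ z ∈ ann R, α * f (β * z) = α * β ^ k * f z) →
        ∃ c : ℂ, ∀ z ∈ ann R, f z = c * z ^ k) ∧
      (∀ c : ℂ, ∀ z ∈ ann R, α * (c * (β * z) ^ k) = α * β ^ k * (c * z ^ k))) := by
  have hα0 : α ≠ 0 := norm_pos_iff.1 (by rw [hα]; exact one_pos)
  have heig : ∀ (k : ℤ) (c z : ℂ), α * (c * (β * z) ^ k) = α * β ^ k * (c * z ^ k) :=
    fun k c z => by rw [mul_zpow]; ring
  refine ⟨fun lam => ⟨?_, ?_⟩, fun k => ⟨fun f hf hk => ?_, fun c z _ => heig k c z⟩⟩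
  · rintro ⟨f, hf, ⟨z, hz, hfz⟩, hlam⟩
    obtain ⟨k, hk⟩ := exists_eq_zpow_of_rotate_eq_mul (μ := lam / α) hf.continuousOn hβ
      (fun w hw => by rw [div_mul_eq_mul_div, ← hlam w hw, mul_div_cancel_left₀ _ hα0]) hz hfz
    exact ⟨k, by rw [← hk, mul_div_cancel₀ _ hα0]⟩
  · rintro ⟨k, rfl⟩
    refine ⟨fun z => z ^ k, fun z hz => ?_, ⟨1, mem_ann_of_norm_eq_one hR norm_one, by simp⟩,
      fun z _ => by simpa using heig k 1 z⟩
    exact (differentiableAt_zpow.2 (Or.inl (ne_zero_of_mem_ann hR hz))).differentiableWithinAt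
  · exact eq_mul_zpow_of_rotate_eq_mul hR hf hβ hap fun w hw =>
      mul_left_cancel₀ hα0 (by rw [hk w hw, mul_assoc])
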